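/- Assume k ≥ 2. Fix a subset T ⊆ Y with |T| = k and a subset S ⊆ T, and define A^{T,S} = {u ∈ U_2 : Σ_{i∈T} u_i = σ_k(u); 0 ≤ u_y ≤ 1 for all y ∈ S; and 1 ≤ u_y ≤ 1 + (1/(k−1))·Σ_{j∈T∖{y}} u_j for all y ∈ T∖S}. Then for every y ∈ Y the map u ↦ L^(2)(u,y) is affine on A^{T,S}: there exist a ∈ ℝ^n and b ∈ ℝ such that L^(2)(u,y) = ⟨a,u⟩ + b for all u ∈ A^{T,S}. -/

import Mathlib

open scoped NNReal

def simplex (n : ℕ) : Set (Fin n → ℝ) := {p | (∀ i, 0 ≤ p i) ∧ ∑ i, p i = 1}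

noncomputable def sigmaTop (n m : ℕ) (u : Fin n → ℝ) : ℝ :=
  if h : ((Finset.univ : Finset (Fin n)).powersetCard m).Nonempty then
    ((Finset.univ : Finset (Fin n)).powersetCard m).sup' h (fun S => ∑ i ∈ S, u i)
  else 0

noncomputable def Lk (n k : ℕ) (u : Fin n → ℝ) (y : Fin n) : ℝ :=
  if h : (Finset.Icc 1 n).Nonempty then
    (Finset.Icc 1 n).sup' h
      (fun m => sigmaTop n m u / (m : ℝ) + max 0 (1 - (k : ℝ) / (m : ℝ))) - u y
  else 0

def indic {n : ℕ} (S : Finset (Fin n)) : Fin n → ℝ := fun i => if i ∈ S then 1 else 0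

noncomputable def nthLarge {n : ℕ} (v : Fin n → ℝ) (j : ℕ) : ℝ :=
  if h : n - j < n then v (Tuple.sort v ⟨n - j, h⟩) else 0

noncomputable def L2 (n k : ℕ) (u : Fin n → ℝ) (y : Fin n) : ℝ :=
  max 0 (1 - u y + (1 / (k : ℝ)) * sigmaTop n k (u - Pi.single y 1))

noncomputable def L3 (n k : ℕ) (u : Fin n → ℝ) (y : Fin n) : ℝ :=
  (1 / (k : ℝ)) * ∑ i ∈ Finset.Icc 1 k, max 0 (1 - u y + nthLarge (u - Pi.single y 1) i)

noncomputable def sigmaExcl (n k : ℕ) (u : Fin n → ℝ) (y : Fin n) : ℝ :=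
  if h : ((Finset.univ.erase y).powersetCard k).Nonempty then
    ((Finset.univ.erase y).powersetCard k).sup' h (fun S => ∑ i ∈ S, u i)
  else 0

noncomputable def L4 (n k : ℕ) (u : Fin n → ℝ) (y : Fin n) : ℝ :=
  max 0 (1 - u y + (1 / (k : ℝ)) * sigmaExcl n k u y)

noncomputable def ell2 (k : ℕ) {n : ℕ} (H M : Finset (Fin n)) (y : Fin n) : ℝ :=
  if y ∈ H then 0
  else if y ∈ M then ((H.card : ℝ) + M.card - 1) / ((k : ℝ) - H.card)
  else ((H.card : ℝ) + M.card - 1) / ((k : ℝ) - H.card) + ((k : ℝ) + 1) / k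

noncomputable def ell4 (k : ℕ) {n : ℕ} (T : Finset (Fin n)) (y : Fin n) : ℝ :=
  if y ∈ T then 0 else ((k : ℝ) + 1) / ((k : ℝ) + 1 - T.card)


theorem sum_le_sigmaTop {n m : ℕ} {R : Finset (Fin n)} (hR : R.card = m) (u : Fin n → ℝ) :
    ∑ i ∈ R, u i ≤ sigmaTop n m u := by
  have hmem : R ∈ (Finset.univ : Finset (Fin n)).powersetCard m :=
    Finset.mem_powersetCard.2 ⟨Finset.subset_univ _, hR⟩
  rw [sigmaTop, dif_pos ⟨R, hmem⟩]
  exact Finset.le_sup' (fun Q => ∑ i ∈ Q, u i) hmem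

theorem sigmaTop_eq_of_forall_sum_le {n m : ℕ} {u : Fin n → ℝ} {c : ℝ} {R : Finset (Fin n)}
    (hR : R.card = m) (hc : ∑ i ∈ R, u i = c)
    (hle : ∀ Q : Finset (Fin n), Q.card = m → ∑ i ∈ Q, u i ≤ c) : sigmaTop n m u = c := by
  have hmem : R ∈ (Finset.univ : Finset (Fin n)).powersetCard m :=
    Finset.mem_powersetCard.2 ⟨Finset.subset_univ _, hR⟩
  refine le_antisymm ?_ (hc ▸ sum_le_sigmaTop hR u)
  rw [sigmaTop, dif_pos ⟨R, hmem⟩]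
  exact Finset.sup'_le _ _ fun Q hQ => hle Q (Finset.mem_powersetCard.1 hQ).2

/-- A nonnegative vector with at most `k` nonzero entries is supported on every `k`-set that
attains `sigmaTop n k u`. -/
theorem eq_zero_of_sum_eq_sigmaTop {n k : ℕ} (hkn : k ≤ n) {u : Fin n → ℝ} (h0 : ∀ i, 0 ≤ u i)
    {P T : Finset (Fin n)} (hP : P.card ≤ k) (hu : ∀ i ∉ P, u i = 0)
    (hT : ∑ i ∈ T, u i = sigmaTop n k u) {j : Fin n} (hj : j ∉ T) : u j = 0 := by
  obtain ⟨R, hPR, hR⟩ := Finset.exists_superset_card_eq hP (by simpa using hkn)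
  have hsum : ∑ i ∈ R, u i = ∑ i, u i :=
    Finset.sum_subset (Finset.subset_univ R) fun i _ hi => hu i fun h => hi (hPR h)
  have hle : ∑ i ∈ R, u i ≤ sigmaTop n k u := sum_le_sigmaTop hR u
  have hins : ∑ i ∈ insert j T, u i ≤ ∑ i, u i :=
    Finset.sum_le_sum_of_subset_of_nonneg (Finset.subset_univ _) fun i _ _ => h0 i
  rw [Finset.sum_insert hj] at hins
  linarith [h0 j]

theorem sum_sub_single {n : ℕ} (u : Fin n → ℝ) (y : Fin n) (R : Finset (Fin n)) :
    ∑ i ∈ R, (u - Pi.single y 1 : Fin n → ℝ) i = ∑ i ∈ R, u i - if y ∈ R then 1 else 0 := by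
  simp [Finset.sum_sub_distrib]

theorem sum_add_le_sum_univ {n : ℕ} {u : Fin n → ℝ} (h0 : ∀ i, 0 ≤ u i) {y : Fin n}
    {R : Finset (Fin n)} (hy : y ∉ R) : u y + ∑ i ∈ R, u i ≤ ∑ i, u i := by
  rw [← Finset.sum_insert hy]
  exact Finset.sum_le_sum_of_subset_of_nonneg (Finset.subset_univ _) fun i _ _ => h0 i

theorem sum_le_sum_univ {n : ℕ} {u : Fin n → ℝ} (h0 : ∀ i, 0 ≤ u i) (R : Finset (Fin n)) :
    ∑ i ∈ R, u i ≤ ∑ i, u i :=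
  Finset.sum_le_sum_of_subset_of_nonneg (Finset.subset_univ _) fun i _ _ => h0 i

theorem stmt10 (n k : ℕ) (hk : 2 ≤ k) (hkn : k < n)
    (T : Finset (Fin n)) (hT : T.card = k) (S : Finset (Fin n)) (hS : S ⊆ T) (y : Fin n) :
    ∃ a : Fin n → ℝ, ∃ b : ℝ, ∀ u : Fin n → ℝ,
      ((∀ i, 0 ≤ u i) ∧ (∃ T' : Finset (Fin n), T'.card ≤ k ∧ ∀ i ∉ T', u i = 0) ∧
        (∀ i, u i ≤ 1 + (sigmaTop n k u - u i) / ((k : ℝ) - 1)) ∧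
        (∑ i ∈ T, u i) = sigmaTop n k u ∧
        (∀ z ∈ S, 0 ≤ u z ∧ u z ≤ 1) ∧
        (∀ z ∈ T \ S, 1 ≤ u z ∧ u z ≤ 1 + (1 / ((k : ℝ) - 1)) * ∑ j ∈ T.erase z, u j)) →
      L2 n k u y = (∑ i, a i * u i) + b := by
  have hk0 : (0 : ℝ) < k := by positivity
  have hk1 : (0 : ℝ) < (k : ℝ) - 1 := by
    have : (2 : ℝ) ≤ k := by exact_mod_cast hk
    linarith
  by_cases hyT : y ∈ T
  · by_cases hyS : y ∈ S
    · refine ⟨fun i => 1 / k - (if i = y then 1 + 1 / (k : ℝ) else 0), 1, ?_⟩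
      rintro u ⟨h0, ⟨P, hP, hPu⟩, -, hTu, hSu, -⟩
      have hsupp : ∀ j, j ∉ T → u j = 0 := fun j hj =>
        eq_zero_of_sum_eq_sigmaTop hkn.le h0 hP hPu hTu hj
      have hsum : ∑ i ∈ T, u i = ∑ i, u i :=
        Finset.sum_subset (Finset.subset_univ T) fun i _ hi => hsupp i hi
      obtain ⟨z, hz⟩ : ∃ z, z ∉ T := by
        by_contra! h
        have := Finset.card_le_card (fun i _ => h i : Finset.univ ⊆ T)
        simp at this
        omega
      have hzy : y ≠ z := fun h => hz (h ▸ hyT)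
      have hy1 := (hSu y hyS).2
      have hsig : sigmaTop n k (u - Pi.single y 1) = ∑ i, u i - u y := by
        have hz' : z ∉ T.erase y := fun h => hz (Finset.mem_of_mem_erase h)
        refine sigmaTop_eq_of_forall_sum_le (R := insert z (T.erase y)) ?_ ?_ fun Q _ => ?_
        · rw [Finset.card_insert_of_notMem hz', Finset.card_erase_of_mem hyT]
          omega
        · have := Finset.add_sum_erase T u hyT
          rw [sum_sub_single, if_neg (by simp [hzy]), Finset.sum_insert hz', hsupp z hz]
          linarith
        · rw [sum_sub_single]
          split_ifs with hQ
          · linarith [sum_le_sum_univ h0 Q]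
          · linarith [sum_add_le_sum_univ h0 hQ]
      have hnonneg : 0 ≤ 1 / (k : ℝ) * (∑ i, u i - u y) :=
        mul_nonneg (by positivity) (sub_nonneg.2 (by simpa using sum_le_sum_univ h0 {y}))
      rw [L2, hsig, max_eq_right (by linarith)]
      simp only [sub_mul, Finset.sum_sub_distrib, ← Finset.mul_sum, ite_mul, zero_mul,
        Finset.sum_ite_eq', Finset.mem_univ, if_true]
      ring
    · refine ⟨fun i => 1 / k - (if i = y then 1 else 0), 1 - 1 / k, ?_⟩
      rintro u ⟨h0, ⟨P, hP, hPu⟩, -, hTu, -, hTSu⟩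
      have hsum : ∑ i ∈ T, u i = ∑ i, u i :=
        Finset.sum_subset (Finset.subset_univ T) fun i _ hi =>
          eq_zero_of_sum_eq_sigmaTop hkn.le h0 hP hPu hTu hi
      obtain ⟨hy1, hy2⟩ := hTSu y (Finset.mem_sdiff.2 ⟨hyT, hyS⟩)
      have hsig : sigmaTop n k (u - Pi.single y 1) = ∑ i, u i - 1 := by
        refine sigmaTop_eq_of_forall_sum_le hT ?_ fun Q _ => ?_
        · rw [sum_sub_single, if_pos hyT, hsum]
        · rw [sum_sub_single]
          split_ifs with hQ
          · linarith [sum_le_sum_univ h0 Q]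
          · linarith [sum_add_le_sum_univ h0 hQ]
      have hnonneg : 0 ≤ 1 - u y + 1 / (k : ℝ) * (∑ i, u i - 1) := by
        have herase : ∑ j ∈ T.erase y, u j = ∑ i, u i - u y := by
          linarith [Finset.add_sum_erase T u hyT]
        rw [herase, one_div_mul_eq_div, ← sub_le_iff_le_add', le_div_iff₀ hk1] at hy2
        have hdiv : u y - 1 ≤ (∑ i, u i - 1) / k := by
          rw [le_div_iff₀ hk0]
          linarith
        rw [one_div_mul_eq_div]
        linarith
      rw [L2, hsig, max_eq_right hnonneg]
      simp only [sub_mul, Finset.sum_sub_distrib, ← Finset.mul_sum, ite_mul, zero_mul, one_mul,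
        Finset.sum_ite_eq', Finset.mem_univ, if_true]
      ring
  · refine ⟨fun _ => 1 / k, 1, ?_⟩
    rintro u ⟨h0, ⟨P, hP, hPu⟩, -, hTu, -, -⟩
    have hsupp : ∀ j, j ∉ T → u j = 0 := fun j hj =>
      eq_zero_of_sum_eq_sigmaTop hkn.le h0 hP hPu hTu hj
    have hsum : ∑ i ∈ T, u i = ∑ i, u i :=
      Finset.sum_subset (Finset.subset_univ T) fun i _ hi => hsupp i hi
    have hsig : sigmaTop n k (u - Pi.single y 1) = ∑ i, u i := by
      refine sigmaTop_eq_of_forall_sum_le hT ?_ fun Q _ => ?_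
      · rw [sum_sub_single, if_neg hyT, hsum, sub_zero]
      · rw [sum_sub_single]
        split_ifs <;> linarith [sum_le_sum_univ h0 Q]
    have hnonneg : 0 ≤ 1 / (k : ℝ) * ∑ i, u i :=
      mul_nonneg (by positivity) (Finset.sum_nonneg fun i _ => h0 i)
    rw [L2, hsig, hsupp y hyT, max_eq_right (by linarith), ← Finset.mul_sum]
    ring
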